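/- Let Q denote the Minkowski quadratic form on ℝ⁴ and B the Minkowski bilinear form: Q(x) = B(x,x), B(x,y) = −x₀y₀ + x₁y₁ + x₂y₂ + x₃y₃. Fix κ > 0. For integrable f, h : ℝ⁴ → ℝ set s(f,h) = −(κ²/(8π)) · ∫∫_{ℝ⁴×ℝ⁴} f(x) · h(y) · sgn(x₀ − y₀) · 1_{Q(x−y) < 0} dx dy, and for integrable f, g : ℝ⁴ → ℝ define the kernel pairing L(f,g) = ∫∫_{ℝ⁴×ℝ⁴} f(x) · log|Q(x−y)| · g(y) dx dy and the cutoff pairing L₋(f,g) = (1/4)·min(L(f+g, f+g), 0) − (1/4)·min(L(f−g, f−g), 0). Given smooth compactly supported χ_p, χ_q, ψ : ℝ⁴ → ℝ and α > 0, set Δχ = χ_p − χ_q, P_ψΔχ = Δχ − (∫Δχ)·ψ, and define D_{α,ψ}(χ_p, χ_q) = ∫∫_{ℝ⁴×ℝ⁴} B(x,y)·Δχ(x)·Δχ(y) dx dy − (κ²/(4π²))·L₋(P_ψΔχ, P_ψΔχ) + 4ακ²·(∫Δχ)² + (1/(ακ²))·s(Δχ, ψ)². If ∫ χ_p = ∫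 χ_q = 1 and ∫ ψ = 1, then as α → ∞ the quantity D_{α,ψ}(χ_p, χ_q) converges to ∫∫_{ℝ⁴×ℝ⁴} B(x,y)·Δχ(x)·Δχ(y) dx dy − (κ²/(4π²))·L₋(Δχ, Δχ), a limit which is independent of ψ. -/

import Mathlib

open Real MeasureTheory Filter

/-- The Minkowski bilinear form on `ℝ⁴`. -/
noncomputable def minkB (x y : EuclideanSpace ℝ (Fin 4)) : ℝ :=
  -(x 0 * y 0) + x 1 * y 1 + x 2 * y 2 + x 3 * y 3

/-- The Minkowski quadratic form on `ℝ⁴`. -/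
noncomputable def minkQ (x : EuclideanSpace ℝ (Fin 4)) : ℝ := minkB x x

/-- The (scalar-valued) symplectic pairing `s(f,h)`. -/
noncomputable def sPair (κ : ℝ) (f h : EuclideanSpace ℝ (Fin 4) → ℝ) : ℝ :=
  -(κ ^ 2 / (8 * π)) *
    ∫ x : EuclideanSpace ℝ (Fin 4), ∫ y : EuclideanSpace ℝ (Fin 4),
      f x * h y * Real.sign (x 0 - y 0) * (if minkQ (x - y) < 0 then (1 : ℝ) else 0)

/-- The logarithmic kernel pairing `L(f,g)`. -/
noncomputable def logPair (f g : EuclideanSpace ℝ (Fin 4) → ℝ) : ℝ :=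
  ∫ x : EuclideanSpace ℝ (Fin 4), ∫ y : EuclideanSpace ℝ (Fin 4),
    f x * Real.log |minkQ (x - y)| * g y

/-- The cutoff logarithmic pairing `L₋(f,g)`. -/
noncomputable def logPairMinus (f g : EuclideanSpace ℝ (Fin 4) → ℝ) : ℝ :=
  (1 / 4) * min (logPair (f + g) (f + g)) 0 - (1 / 4) * min (logPair (f - g) (f - g)) 0

/-- The distance functional `D_{α,ψ}(χ_p, χ_q)` built from the Dereziński–Meissner state. -/
noncomputable def distFun (κ α : ℝ) (ψ χp χq : EuclideanSpace ℝ (Fin 4) → ℝ) : ℝ :=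
  (∫ x : EuclideanSpace ℝ (Fin 4), ∫ y : EuclideanSpace ℝ (Fin 4),
      minkB x y * (χp - χq) x * (χp - χq) y) -
    κ ^ 2 / (4 * π ^ 2) *
      logPairMinus (fun x => (χp - χq) x - (∫ z, (χp - χq) z) * ψ x)
        (fun x => (χp - χq) x - (∫ z, (χp - χq) z) * ψ x) +
    4 * α * κ ^ 2 * (∫ z, (χp - χq) z) ^ 2 +
    (1 / (α * κ ^ 2)) * sPair κ (χp - χq) ψ ^ 2

/-- As `α → ∞`, the distance functional `D_{α,ψ}(χ_p, χ_q)` converges to a limit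
independent of `ψ`. -/
theorem distFun_tendsto (κ : ℝ) (hκ : 0 < κ)
    (ψ χp χq : EuclideanSpace ℝ (Fin 4) → ℝ)
    (hψs : ContDiff ℝ (⊤ : ℕ∞) ψ) (hψc : HasCompactSupport ψ)
    (hps : ContDiff ℝ (⊤ : ℕ∞) χp) (hpc : HasCompactSupport χp)
    (hqs : ContDiff ℝ (⊤ : ℕ∞) χq) (hqc : HasCompactSupport χq)
    (hp1 : (∫ x, χp x) = 1) (hq1 : (∫ x, χq x) = 1) (hψ1 : (∫ x, ψ x) = 1) :
    Tendsto (fun α : ℝ => distFun κ α ψ χp χq) atTop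
      (nhds ((∫ x : EuclideanSpace ℝ (Fin 4), ∫ y : EuclideanSpace ℝ (Fin 4),
          minkB x y * (χp - χq) x * (χp - χq) y) -
        κ ^ 2 / (4 * π ^ 2) * logPairMinus (χp - χq) (χp - χq))) := by
  have hmass : (∫ z, (χp - χq) z) = 0 := by
    rw [integral_sub' (hps.continuous.integrable_of_hasCompactSupport hpc)
      (hqs.continuous.integrable_of_hasCompactSupport hqc), hp1, hq1, sub_self]
  have hdecay : Tendsto (fun α : ℝ => 1 / (α * κ ^ 2) * sPair κ (χp - χq) ψ ^ 2) atTop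
      (nhds 0) := by
    have hscale : Tendsto (fun α : ℝ => α * κ ^ 2) atTop atTop :=
      tendsto_id.atTop_mul_const (by positivity)
    simpa [one_div] using hscale.inv_tendsto_atTop.mul_const (sPair κ (χp - χq) ψ ^ 2)
  simp only [distFun, hmass, zero_mul, sub_zero, mul_zero, add_zero, ne_eq, OfNat.ofNat_ne_zero,
    not_false_eq_true, zero_pow]
  simpa only [add_zero] using tendsto_const_nhds.add hdecay
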